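/- For each fixed α ∈ [1,2] there is a constant C such that for all real y ≥ 2: |∑_{y < n ≤ y^α, P⁺(n) ≤ y} 1/n − (−α·log α + 2α − 2)·log y| ≤ C, where the sum runs over integers n with y < n ≤ y^α all of whose prime factors are at most y. -/

import Mathlib

open Real Finset

/-- `P⁺(n)`: the largest prime factor of `n` (with `P⁺(1) = 0`). -/
def Pplus (n : ℕ) : ℕ := n.primeFactors.sup id

/-- The summand of the first Mertens theorem. -/
noncomputable def primeLogDiv (n : ℕ) : ℝ := if n.Prime then log n / n else 0

theorem primeLogDiv_nonneg (n : ℕ) : 0 ≤ primeLogDiv n := by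
  unfold primeLogDiv
  split_ifs
  · exact div_nonneg (log_natCast_nonneg n) n.cast_nonneg
  · exact le_rfl

theorem log_factorial_eq_sum_primes (N : ℕ) :
    log (N.factorial : ℝ) =
      ∑ p ∈ Ioc 0 N with p.Prime, (N.factorial.factorization p : ℝ) * log p := by
  rw [log_nat_eq_sum_factorization]
  refine Finsupp.sum_of_support_subset _ (fun p hp ↦ ?_) _ (by simp)
  have hp' := Nat.prime_of_mem_primeFactors hp
  have hd := Nat.dvd_of_mem_primeFactors hp
  simp [hp', hp'.pos, (hp'.dvd_factorial).1 hd]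

theorem sum_log_div_mul_sub_one_le (N : ℕ) (hN : 1 ≤ N) :
    ∑ n ∈ Ioc 1 N, log n / (n * (n - 1)) ≤ 2 - (log N + 2) / N := by
  induction N, hN using Nat.le_induction with
  | base => simp
  | succ m hm ih =>
    rw [← Finset.insert_Ioc_right_eq_Ioc_add_one hm, sum_insert (by simp)]
    have hm0 : (1 : ℝ) ≤ m := by exact_mod_cast hm
    have hlog : log ((m : ℝ) + 1) ≤ log m + 1 / m := by
      have := log_le_sub_one_of_pos (x := ((m : ℝ) + 1) / m) (by positivity)
      rw [log_div (by positivity) (by positivity)] at this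
      have h2 : ((m : ℝ) + 1) / m - 1 = 1 / m := by field_simp; ring
      linarith
    have key : log ((m : ℝ) + 1) / ((m + 1) * m) ≤
        (log m + 2) / m - (log ((m : ℝ) + 1) + 2) / (m + 1) := by
      have h1 : (log ((m : ℝ) + 1) - 1 / m + 2) / m ≤ (log m + 2) / m := by
        gcongr; linarith
      have h2 : (log ((m : ℝ) + 1) - 1 / m + 2) / m - (log ((m : ℝ) + 1) + 2) / (m + 1)
          - log ((m : ℝ) + 1) / ((m + 1) * m) = (m - 1) / (m ^ 2 * (m + 1)) := by
        field_simp; ring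
      have h3 : 0 ≤ ((m : ℝ) - 1) / (m ^ 2 * (m + 1)) :=
        div_nonneg (by linarith) (by positivity)
      linarith
    push_cast
    rw [add_sub_cancel_right]
    linarith

theorem sum_primeLogDiv_eq (N : ℕ) :
    ∑ n ∈ Icc 0 N, primeLogDiv n = ∑ p ∈ Ioc 0 N with p.Prime, log p / p := by
  rw [← add_sum_Ioc_eq_sum_Icc (Nat.zero_le N), sum_filter]
  simp [primeLogDiv]

theorem sum_primeLogDiv_le (N : ℕ) (hN : 1 ≤ N) :
    ∑ n ∈ Icc 0 N, primeLogDiv n ≤ log N + log 4 := by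
  have hN0 : (1 : ℝ) ≤ N := by exact_mod_cast hN
  have h1 : ∑ p ∈ Ioc 0 N with p.Prime, (N * (log p / p) - log p) ≤ log (N.factorial : ℝ) := by
    rw [log_factorial_eq_sum_primes]
    refine sum_le_sum fun p hp ↦ ?_
    have hp' := (mem_filter.1 hp).2
    have hv : N / p ≤ N.factorial.factorization p := by
      rw [Nat.factorization_factorial hp' (b := Nat.log p N + 2) (by omega)]
      simpa using single_le_sum (f := fun i ↦ N / p ^ i) (fun _ _ ↦ Nat.zero_le _)
        (show 1 ∈ Ico 1 (Nat.log p N + 2) by simp)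
    have hv' : ((N / p : ℕ) : ℝ) ≤ N.factorial.factorization p := by exact_mod_cast hv
    have hfl : (N : ℝ) / p - 1 ≤ ((N / p : ℕ) : ℝ) := by
      have := Nat.lt_floor_add_one ((N : ℝ) / p)
      rw [Nat.floor_div_eq_div] at this
      linarith
    calc (N : ℝ) * (log p / p) - log p = (N / p - 1) * log p := by ring
      _ ≤ _ := by gcongr; linarith
  have h2 : log (N.factorial : ℝ) ≤ N * log N := by
    rw [← log_pow]
    exact log_le_log (by positivity) (by exact_mod_cast Nat.factorial_le_pow N)
  have h3 := Chebyshev.theta_le_log4_mul_x (x := N) (by positivity)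
  rw [Chebyshev.theta, Nat.floor_natCast] at h3
  rw [sum_sub_distrib, ← mul_sum, ← sum_primeLogDiv_eq] at h1
  refine le_of_mul_le_mul_left (a := (N : ℝ)) ?_ (by linarith)
  linarith

theorem le_sum_primeLogDiv (N : ℕ) (hN : 1 ≤ N) :
    log N - 3 ≤ ∑ n ∈ Icc 0 N, primeLogDiv n := by
  have hN0 : (1 : ℝ) ≤ N := by exact_mod_cast hN
  have h1 : log (N.factorial : ℝ) ≤
      ∑ p ∈ Ioc 0 N with p.Prime, (N * (log p / p) + N * (log p / (p * (p - 1)))) := by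
    rw [log_factorial_eq_sum_primes]
    refine sum_le_sum fun p hp ↦ ?_
    have hp' := (mem_filter.1 hp).2
    have hp1 : (1 : ℝ) < p := by exact_mod_cast hp'.one_lt
    have hp2 : (0 : ℝ) < p - 1 := by linarith
    have hv : (p - 1) * N.factorial.factorization p ≤ N := by
      rw [Nat.sub_one_mul_factorization_factorial hp']; omega
    have hv' : ((p : ℝ) - 1) * N.factorial.factorization p ≤ N := by
      have : (((p - 1 : ℕ) : ℝ)) * N.factorial.factorization p ≤ N := by exact_mod_cast hv
      rwa [Nat.cast_pred hp'.pos] at this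
    have hv2 : (N.factorial.factorization p : ℝ) ≤ N / (p - 1) := by
      rw [le_div_iff₀ hp2]; linarith
    calc (N.factorial.factorization p : ℝ) * log p ≤ N / (p - 1) * log p := by gcongr
      _ = _ := by field_simp; ring
  have h2 : N * log N - N ≤ log (N.factorial : ℝ) := by
    have h := log_le_log (by positivity) (pow_div_factorial_le_exp (x := N) (by positivity) N)
    rw [log_exp, log_div (by positivity) (by positivity), log_pow] at h
    linarith
  have h3 : ∑ p ∈ Ioc 0 N with p.Prime, log p / (p * ((p : ℝ) - 1)) ≤ 2 := by
    have h := sum_log_div_mul_sub_one_le N hN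
    have h0 : 0 ≤ (log N + 2) / N := by positivity
    refine le_trans (sum_le_sum_of_subset_of_nonneg (t := Ioc 1 N) ?_ ?_) (h.trans (by linarith))
    · intro p hp
      simp only [mem_filter, mem_Ioc] at hp ⊢
      exact ⟨hp.2.one_lt, hp.1.2⟩
    · intro n hn _
      have : (1 : ℝ) < n := by exact_mod_cast (mem_Ioc.1 hn).1
      exact div_nonneg (log_natCast_nonneg n) (mul_nonneg (by linarith) (by linarith))
  rw [sum_add_distrib, ← mul_sum, ← mul_sum, ← sum_primeLogDiv_eq] at h1
  refine le_of_mul_le_mul_left (a := (N : ℝ)) ?_ (by linarith)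
  nlinarith

/-- The first Mertens theorem. -/
theorem abs_sum_primeLogDiv_sub_log_le {t : ℝ} (ht : 1 ≤ t) :
    |∑ n ∈ Icc 0 ⌊t⌋₊, primeLogDiv n - log t| ≤ 4 := by
  have hN : 1 ≤ ⌊t⌋₊ := Nat.floor_pos.2 ht
  have hN0 : (1 : ℝ) ≤ ⌊t⌋₊ := by exact_mod_cast hN
  have h1 := sum_primeLogDiv_le _ hN
  have h2 := le_sum_primeLogDiv _ hN
  have h3 : log ⌊t⌋₊ ≤ log t := log_le_log (by linarith) (Nat.floor_le (by linarith))
  have h4 : log t ≤ log 2 + log ⌊t⌋₊ := by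
    rw [← log_mul (by norm_num) (by linarith)]
    exact log_le_log (by linarith) (by linarith [Nat.lt_floor_add_one t])
  have h5 : log 4 = 2 * log 2 := by
    rw [show (4 : ℝ) = 2 ^ 2 by norm_num, log_pow]; norm_num
  rw [abs_le]
  constructor <;> linarith [log_two_lt_d9]

theorem abs_sum_primes_log_div_sub_le {x y : ℝ} (hy : 1 < y) (hyx : y ≤ x) :
    |∑ p ∈ Ioc ⌊y⌋₊ ⌊x⌋₊, (log x / log p - 1) * primeLogDiv p
      - (log x * (log (log x) - log (log y)) - (log x - log y))| ≤ 8 * (log x / log y - 1) := by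
  have hly : 0 < log y := log_pos hy
  have hlx : 0 < log x := log_pos (hy.trans_le hyx)
  set g : ℝ → ℝ := fun t ↦ log x / (t * log t ^ 2) with hg
  have hpos : ∀ t ∈ Set.Icc y x, 0 < t ∧ 0 < log t := fun t ht ↦
    ⟨by linarith [ht.1], log_pos (hy.trans_le ht.1)⟩
  have hf : ∀ t ∈ Set.Icc y x, HasDerivAt (fun t ↦ log x / log t - 1) (-g t) t := by
    intro t ht
    obtain ⟨h0, h1⟩ := hpos t ht
    refine (((hasDerivAt_const t (log x)).div (hasDerivAt_log h0.ne') h1.ne').sub_const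
      1).congr_deriv ?_
    simp only [hg]
    field_simp
    ring
  have hgc : ContinuousOn g (Set.Icc y x) := by
    refine continuousOn_const.div (continuousOn_id.mul ((continuousOn_log.mono ?_).pow 2)) ?_
    · intro t ht; exact (hpos t ht).1.ne'
    · intro t ht; exact (mul_pos (hpos t ht).1 (pow_pos (hpos t ht).2 2)).ne'
  have hgi : MeasureTheory.IntegrableOn g (Set.Icc y x) := hgc.integrableOn_Icc
  have habel := sum_mul_eq_sub_sub_integral_mul primeLogDiv (f := fun t ↦ log x / log t - 1)
    (by linarith) hyx (fun t ht ↦ (hf t ht).differentiableAt)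
    (hgi.neg.congr_fun (fun t ht ↦ (hf t ht).deriv.symm) measurableSet_Icc)
  set A : ℝ → ℝ := fun t ↦ ∑ k ∈ Icc 0 ⌊t⌋₊, primeLogDiv k with hA
  have hint : ∫ t in Set.Ioc y x, deriv (fun t ↦ log x / log t - 1) t * A t =
      -∫ t in y..x, g t * A t := by
    rw [intervalIntegral.integral_of_le hyx, ← MeasureTheory.integral_neg]
    refine MeasureTheory.setIntegral_congr_fun measurableSet_Ioc fun t ht ↦ ?_
    simp only [(hf t (Set.Ioc_subset_Icc_self ht)).deriv, neg_mul]
  have hgA : IntervalIntegrable (fun t ↦ g t * A t) MeasureTheory.volume y x := by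
    rw [intervalIntegrable_iff_integrableOn_Icc_of_le hyx]
    exact integrableOn_mul_sum_Icc primeLogDiv (by linarith) hgi
  have hgl (r : ℝ) : IntervalIntegrable (fun t ↦ g t * (log t + r)) MeasureTheory.volume y x := by
    refine ContinuousOn.intervalIntegrable_of_Icc hyx (hgc.mul ((continuousOn_log.mono ?_).add
      continuousOn_const))
    intro t ht; exact (hpos t ht).1.ne'
  have hval (r : ℝ) : ∫ t in y..x, g t * (log t + r) =
      log x * (log (log x) - log (log y)) + r * (log x / log y - 1) := by
    rw [intervalIntegral.integral_eq_sub_of_hasDerivAt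
      (f := fun t ↦ log x * (log (log t) - r / log t)) ?_ (hgl r)]
    · field_simp
      ring
    · intro t ht
      rw [Set.uIcc_of_le hyx] at ht
      obtain ⟨h0, h1⟩ := hpos t ht
      have hl := hasDerivAt_log h0.ne'
      refine ((((hasDerivAt_log h1.ne').comp t hl).sub
        ((hasDerivAt_const t r).div hl h1.ne')).const_mul (log x)).congr_deriv ?_
      simp only [hg]
      field_simp
      ring
  have hgn : ∀ t ∈ Set.Icc y x, 0 ≤ g t := fun t ht ↦ by
    obtain ⟨h0, h1⟩ := hpos t ht
    simp only [hg]; positivity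
  have hAb : ∀ t ∈ Set.Icc y x, log t + (-4) ≤ A t ∧ A t ≤ log t + 4 := fun t ht ↦ by
    have := abs_le.1 (abs_sum_primeLogDiv_sub_log_le (hy.le.trans ht.1))
    constructor <;> simp only [hA] <;> linarith
  have hup : ∫ t in y..x, g t * A t ≤ ∫ t in y..x, g t * (log t + 4) :=
    intervalIntegral.integral_mono_on hyx hgA (hgl 4) fun t ht ↦
      mul_le_mul_of_nonneg_left (hAb t ht).2 (hgn t ht)
  have hlo : ∫ t in y..x, g t * (log t + (-4)) ≤ ∫ t in y..x, g t * A t :=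
    intervalIntegral.integral_mono_on hyx (hgl (-4)) hgA fun t ht ↦
      mul_le_mul_of_nonneg_left (hAb t ht).1 (hgn t ht)
  rw [hval] at hup hlo
  rw [hint, div_self hlx.ne', sub_self, zero_mul] at habel
  rw [habel]
  have hq : 0 ≤ log x / log y - 1 := by
    rw [sub_nonneg, le_div_iff₀ hly, one_mul]
    exact log_le_log (by linarith) hyx
  obtain ⟨h1, h2⟩ := hAb y ⟨le_rfl, hyx⟩
  have h3 := mul_le_mul_of_nonneg_left h1 hq
  have h4 := mul_le_mul_of_nonneg_left h2 hq
  have h5 : (log x / log y - 1) * log y = log x - log y := by field_simp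
  rw [mul_add, h5] at h3 h4
  change |0 - (log x / log y - 1) * A y - _ - _| ≤ _
  rw [abs_le]
  constructor <;> linarith

theorem sum_one_div_primes_le {x y : ℝ} (hy : 2 ≤ y) (hyx : y ≤ x) :
    ∑ p ∈ Ioc ⌊y⌋₊ ⌊x⌋₊ with p.Prime, (1 : ℝ) / p ≤ (log x / log y - 1) + 8 / log 2 := by
  have hl2 : 0 < log 2 := log_pos (by norm_num)
  have hly : log 2 ≤ log y := log_le_log (by norm_num) hy
  have h1 : log y * ∑ p ∈ Ioc ⌊y⌋₊ ⌊x⌋₊ with p.Prime, (1 : ℝ) / p ≤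
      ∑ p ∈ Ioc ⌊y⌋₊ ⌊x⌋₊, primeLogDiv p := by
    rw [mul_sum, sum_filter]
    refine sum_le_sum fun p hp ↦ ?_
    have hyp : y < p := (Nat.floor_lt (by linarith)).1 (mem_Ioc.1 hp).1
    unfold primeLogDiv
    split_ifs
    · rw [mul_one_div]
      gcongr
    · exact le_rfl
  have h2 : ∑ k ∈ Icc 0 ⌊y⌋₊, primeLogDiv k + ∑ p ∈ Ioc ⌊y⌋₊ ⌊x⌋₊, primeLogDiv p =
      ∑ k ∈ Icc 0 ⌊x⌋₊, primeLogDiv k := by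
    rw [← add_sum_Ioc_eq_sum_Icc (Nat.zero_le _), ← add_sum_Ioc_eq_sum_Icc (Nat.zero_le _),
      add_assoc, sum_Ioc_consecutive _ (Nat.zero_le _) (Nat.floor_le_floor hyx)]
  have h3 := abs_le.1 (abs_sum_primeLogDiv_sub_log_le (t := y) (by linarith))
  have h4 := abs_le.1 (abs_sum_primeLogDiv_sub_log_le (t := x) (by linarith))
  have h5 : log y * ∑ p ∈ Ioc ⌊y⌋₊ ⌊x⌋₊ with p.Prime, (1 : ℝ) / p ≤ log x - log y + 8 := by
    linarith
  rw [mul_comm, ← le_div_iff₀ (by linarith)] at h5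
  refine h5.trans ?_
  rw [add_div, sub_div, div_self (by linarith)]
  gcongr

theorem le_sum_Icc_one_div (t : ℝ) (ht : 0 ≤ t) :
    log t ≤ ∑ n ∈ Icc 1 ⌊t⌋₊, (1 : ℝ) / n := by
  simpa [harmonic_eq_sum_Icc] using log_le_harmonic_floor t ht

theorem sum_Icc_one_div_le (t : ℝ) (ht : 1 ≤ t) :
    ∑ n ∈ Icc 1 ⌊t⌋₊, (1 : ℝ) / n ≤ 1 + log t := by
  simpa [harmonic_eq_sum_Icc] using harmonic_floor_le_one_add_log t ht

theorem le_Pplus {n p : ℕ} (hn : n ≠ 0) (hp : p.Prime) (h : p ∣ n) : p ≤ Pplus n :=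
  Finset.le_sup (f := id) (Nat.mem_primeFactors.2 ⟨hp, h, hn⟩)

theorem Pplus_mem_primeFactors {n : ℕ} (hn : 0 < Pplus n) : Pplus n ∈ n.primeFactors := by
  have hne : n.primeFactors.Nonempty := by
    rw [nonempty_iff_ne_empty]
    intro h
    simp [Pplus, h] at hn
  obtain ⟨p, hp, h⟩ := exists_mem_eq_sup n.primeFactors hne id
  rw [Pplus, h]
  exact hp

theorem Pplus_mul_eq {p m : ℕ} (hp : p.Prime) (hm : 0 < m) (hmp : m ≤ p) :
    Pplus (p * m) = p := by
  have h0 : p * m ≠ 0 := mul_ne_zero hp.ne_zero hm.ne'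
  refine le_antisymm (Finset.sup_le fun q hq ↦ ?_) (le_Pplus h0 hp (dvd_mul_right _ _))
  have hq' := Nat.prime_of_mem_primeFactors hq
  rcases (hq'.dvd_mul).1 (Nat.dvd_of_mem_primeFactors hq) with h | h
  · exact Nat.le_of_dvd hp.pos h
  · exact (Nat.le_of_dvd hm h).trans hmp

theorem sum_filter_lt_Pplus {M N : ℕ} (hM : 1 ≤ M) (hN : N ≤ (M + 1) ^ 2) :
    ∑ n ∈ Icc 1 N with M < Pplus n, (1 : ℝ) / n =
      ∑ p ∈ Ioc M N with p.Prime, (1 : ℝ) / p * ∑ m ∈ Icc 1 (N / p), (1 : ℝ) / m := by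
  simp_rw [mul_sum]
  rw [sum_sigma']
  refine sum_bij' (fun n _ ↦ ⟨Pplus n, n / Pplus n⟩) (fun s _ ↦ s.1 * s.2) ?_ ?_ ?_ ?_ ?_
  · intro n hn
    simp only [mem_filter, mem_Icc] at hn
    obtain ⟨⟨hn1, hnN⟩, hP⟩ := hn
    have hmem := Pplus_mem_primeFactors (Nat.zero_lt_of_lt hP)
    have hdvd := Nat.dvd_of_mem_primeFactors hmem
    have hle := Nat.le_of_dvd (by omega) hdvd
    have hpr := Nat.prime_of_mem_primeFactors hmem
    simp only [mem_sigma, mem_filter, mem_Ioc, mem_Icc]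
    exact ⟨⟨⟨hP, hle.trans hnN⟩, hpr⟩, Nat.div_pos hle hpr.pos, Nat.div_le_div_right hnN⟩
  · rintro ⟨p, m⟩ h
    simp only [mem_sigma, mem_filter, mem_Ioc, mem_Icc] at h ⊢
    obtain ⟨⟨⟨hMp, hpN⟩, hp⟩, hm1, hm⟩ := h
    have h0 : 0 < p * m := Nat.mul_pos hp.pos hm1
    refine ⟨⟨h0, ?_⟩, hMp.trans_le (le_Pplus h0.ne' hp (dvd_mul_right _ _))⟩
    rw [mul_comm]
    exact (Nat.le_div_iff_mul_le hp.pos).1 hm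
  · intro n hn
    simp only [mem_filter, mem_Icc] at hn
    obtain ⟨⟨hn1, hnN⟩, hP⟩ := hn
    exact Nat.mul_div_cancel' (Nat.dvd_of_mem_primeFactors (Pplus_mem_primeFactors (Nat.zero_lt_of_lt hP)))
  · rintro ⟨p, m⟩ h
    simp only [mem_sigma, mem_filter, mem_Ioc, mem_Icc] at h
    obtain ⟨⟨⟨hMp, hpN⟩, hp⟩, hm1, hm⟩ := h
    have hmp : m ≤ p := by
      have h1 : m * p ≤ N := (Nat.le_div_iff_mul_le hp.pos).1 hm
      by_contra! h2
      nlinarith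
    have hP := Pplus_mul_eq hp hm1 hmp
    simp only [hP, Nat.mul_div_cancel_left m hp.pos]
  · intro n hn
    simp only [mem_filter, mem_Icc] at hn
    obtain ⟨⟨hn1, hnN⟩, hP⟩ := hn
    have := Nat.mul_div_cancel' (Nat.dvd_of_mem_primeFactors (Pplus_mem_primeFactors (Nat.zero_lt_of_lt hP)))
    rw [one_div_mul_one_div, ← Nat.cast_mul, this]

/-- Splitting the harmonic sum over `y < n ≤ x` according to whether `n` has a prime factor
exceeding `y`. -/
theorem sum_smooth_add_sum_not_smooth {x y : ℝ} (hy : 1 ≤ y) (hyx : y ≤ x) (hx : x ≤ y ^ 2) :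
    ∑ n ∈ (Icc 1 ⌊x⌋₊).filter (fun n : ℕ ↦ y < (n : ℝ) ∧ (Pplus n : ℝ) ≤ y), (1 : ℝ) / n
      + (∑ p ∈ Ioc ⌊y⌋₊ ⌊x⌋₊ with p.Prime, (1 : ℝ) / p * ∑ m ∈ Icc 1 ⌊x / p⌋₊, (1 : ℝ) / m)
      + ∑ n ∈ Icc 1 ⌊y⌋₊, (1 : ℝ) / n = ∑ n ∈ Icc 1 ⌊x⌋₊, (1 : ℝ) / n := by
  have hy0 : 0 ≤ y := by linarith
  have hN : ⌊x⌋₊ ≤ (⌊y⌋₊ + 1) ^ 2 := by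
    refine Nat.floor_le_of_le (hx.trans ?_)
    push_cast
    gcongr
    exact (Nat.lt_floor_add_one y).le
  simp_rw [Nat.floor_div_natCast]
  rw [← sum_filter_lt_Pplus (Nat.floor_pos.2 hy) hN]
  have hlt (n : ℕ) : y < (n : ℝ) ↔ ⌊y⌋₊ < n := (Nat.floor_lt hy0).symm
  have hle (n : ℕ) : (n : ℝ) ≤ y ↔ n ≤ ⌊y⌋₊ := (Nat.le_floor_iff hy0).symm
  simp_rw [hlt, hle]
  have hfl := Nat.floor_le_floor hyx
  have hsmall : ∑ n ∈ Icc 1 ⌊y⌋₊, (1 : ℝ) / n = ∑ n ∈ Icc 1 ⌊x⌋₊ with n ≤ ⌊y⌋₊, (1 : ℝ) / n := by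
    congr 1
    ext n
    simp only [mem_filter, mem_Icc]
    omega
  rw [hsmall, sum_filter, sum_filter, sum_filter, ← sum_add_distrib, ← sum_add_distrib]
  refine sum_congr rfl fun n hn ↦ ?_
  have hPn : Pplus n ≤ n := Finset.sup_le fun q hq ↦ Nat.le_of_mem_primeFactors hq
  by_cases h1 : ⌊y⌋₊ < n
  · by_cases h2 : ⌊y⌋₊ < Pplus n
    · simp [h1, h2, h1.not_ge, h2.not_ge]
    · simp [h1, h2, h1.not_ge, not_lt.1 h2]
  · have h2 : ¬ ⌊y⌋₊ < Pplus n := by omega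
    simp [h1, h2, not_lt.1 h1]

theorem stmt5 (α : ℝ) (hα : α ∈ Set.Icc (1 : ℝ) 2) :
    ∃ C : ℝ, ∀ y : ℝ, 2 ≤ y →
      |(∑ n ∈ (Finset.Icc 1 ⌊y ^ α⌋₊).filter
            (fun n : ℕ => y < (n : ℝ) ∧ (Pplus n : ℝ) ≤ y),
          (1 : ℝ) / n)
        - (-(α * Real.log α) + 2 * α - 2) * Real.log y| ≤ C := by
  obtain ⟨hα1, hα2⟩ := hα
  refine ⟨10 + 8 / log 2, fun y hy ↦ ?_⟩
  have hy0 : 0 < y := by linarith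
  have hly : 0 < log y := log_pos (by linarith)
  have hyx : y ≤ y ^ α := by simpa using rpow_le_rpow_of_exponent_le (by linarith) hα1
  have hx2 : y ^ α ≤ y ^ 2 := by
    simpa using rpow_le_rpow_of_exponent_le (x := y) (by linarith) hα2
  have hlx : log (y ^ α) = α * log y := log_rpow hy0 α
  have hsplit := sum_smooth_add_sum_not_smooth (by linarith) hyx hx2
  have hP := abs_sum_primes_log_div_sub_le (by linarith) hyx
  have hQ := sum_one_div_primes_le hy hyx
  have hx1 := le_sum_Icc_one_div (y ^ α) (by positivity)
  have hx1' := sum_Icc_one_div_le (y ^ α) (by linarith)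
  have hy1 := le_sum_Icc_one_div y hy0.le
  have hy1' := sum_Icc_one_div_le y (by linarith)
  set x := y ^ α with hx
  have hterm : ∀ p ∈ (Ioc ⌊y⌋₊ ⌊x⌋₊).filter Nat.Prime,
      (log x / log p - 1) * primeLogDiv p = 1 / p * log (x / p) ∧ 1 ≤ x / p := by
    intro p hp
    simp only [mem_filter, mem_Ioc] at hp
    obtain ⟨⟨-, hpx⟩, hp⟩ := hp
    have hp1 : (1 : ℝ) < p := by exact_mod_cast hp.one_lt
    have hlp : 0 < log (p : ℝ) := log_pos hp1
    have hpx' : (p : ℝ) ≤ x := (Nat.le_floor_iff (by linarith)).1 hpx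
    refine ⟨?_, (one_le_div (by linarith)).2 hpx'⟩
    rw [primeLogDiv, if_pos hp, log_div (by linarith) (by linarith)]
    field_simp
  have hPeq : ∑ p ∈ Ioc ⌊y⌋₊ ⌊x⌋₊, (log x / log p - 1) * primeLogDiv p =
      ∑ p ∈ Ioc ⌊y⌋₊ ⌊x⌋₊ with p.Prime, 1 / p * log (x / p) := by
    rw [← sum_congr rfl fun p hp ↦ (hterm p hp).1, sum_filter]
    refine sum_congr rfl fun p _ ↦ ?_
    split_ifs with h <;> simp [primeLogDiv, h]
  have hlo : ∑ p ∈ Ioc ⌊y⌋₊ ⌊x⌋₊ with p.Prime, 1 / p * log (x / p) ≤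
      ∑ p ∈ Ioc ⌊y⌋₊ ⌊x⌋₊ with p.Prime, (1 : ℝ) / p * ∑ m ∈ Icc 1 ⌊x / p⌋₊, (1 : ℝ) / m := by
    refine sum_le_sum fun p hp ↦ mul_le_mul_of_nonneg_left ?_ (by positivity)
    exact le_sum_Icc_one_div _ (by linarith [(hterm p hp).2])
  have hup : ∑ p ∈ Ioc ⌊y⌋₊ ⌊x⌋₊ with p.Prime, (1 : ℝ) / p * ∑ m ∈ Icc 1 ⌊x / p⌋₊, (1 : ℝ) / m ≤
      ∑ p ∈ Ioc ⌊y⌋₊ ⌊x⌋₊ with p.Prime, (1 : ℝ) / p +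
        ∑ p ∈ Ioc ⌊y⌋₊ ⌊x⌋₊ with p.Prime, 1 / p * log (x / p) := by
    rw [← sum_add_distrib]
    refine sum_le_sum fun p hp ↦ ?_
    rw [← mul_one_add]
    exact mul_le_mul_of_nonneg_left (sum_Icc_one_div_le _ (hterm p hp).2) (by positivity)
  have hdiv : log x / log y = α := by rw [hlx, mul_div_cancel_right₀ _ hly.ne']
  have hll : log (log x) - log (log y) = log α := by
    rw [hlx, log_mul (by linarith) hly.ne']; ring
  rw [hPeq, hll, hdiv, hlx] at hP
  rw [hdiv] at hQ
  rw [hlx] at hx1 hx1'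
  obtain ⟨hP1, hP2⟩ := abs_le.1 hP
  rw [abs_le]
  constructor <;> nlinarith
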